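/- Hölder inequality in Lorentz spaces: let 1 ≤ p₁, p₂ < ∞, 1 ≤ q₁, q₂ ≤ ∞, and suppose 1/p = 1/p₁ + 1/p₂ < 1 and 1/q = 1/q₁ + 1/q₂. Then there is a constant C (depending only on the exponents) such that ‖fg‖_{L^{p,q}} ≤ C ‖f‖_{L^{p₁,q₁}} ‖g‖_{L^{p₂,q₂}} for all measurable f, g. -/

import Mathlib

open MeasureTheory ENNReal
open scoped NNReal

/-- The Lorentz quasinorm `‖f‖_{L^{p,q}}` defined via the distribution function. -/
noncomputable def lorentzNorm {α : Type*} [MeasurableSpace α] (μ : Measure α)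
    (p : ℝ) (q : ℝ≥0∞) (f : α → ℝ) : ℝ≥0∞ :=
  if q = ⊤ then ⨆ t : ℝ, ⨆ _ : 0 < t, ENNReal.ofReal t * (μ {x | t < |f x|}) ^ (1 / p)
  else (∫⁻ t in Set.Ioi (0 : ℝ),
      ENNReal.ofReal p * (ENNReal.ofReal t) ^ (q.toReal - 1) *
        (μ {x | t < |f x|}) ^ (q.toReal / p)) ^ (1 / q.toReal)


lemma lint_pow (r : ℝ) (hr : 0 < r) (a : ℝ≥0∞) :
    ∫⁻ s in Set.Ioi (0 : ℝ), (if ENNReal.ofReal s < a then (ENNReal.ofReal s) ^ (r - 1) else 0)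
      = ENNReal.ofReal (1 / r) * a ^ r := by
  have key : ∀ b : ℝ, 0 ≤ b → ∫⁻ s in Set.Ioi (0 : ℝ),
      (if ENNReal.ofReal s < ENNReal.ofReal b then (ENNReal.ofReal s) ^ (r - 1) else 0)
      = ENNReal.ofReal (1 / r) * (ENNReal.ofReal b) ^ r := by
    intro b hb
    have h1 : ∫⁻ s in Set.Ioi (0 : ℝ),
      (if ENNReal.ofReal s < ENNReal.ofReal b then (ENNReal.ofReal s) ^ (r - 1) else 0)
      = ∫⁻ s in Set.Ioi (0 : ℝ), (Set.Iio b).indicator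
          (fun s => ENNReal.ofReal (s ^ (r - 1))) s := by
      refine setLIntegral_congr_fun measurableSet_Ioi ?_
      intro s hs
      have hs' : 0 < s := hs
      simp only [Set.indicator, Set.mem_Iio]
      simp only [ENNReal.ofReal_lt_ofReal_iff_of_nonneg hs'.le, ENNReal.ofReal_rpow_of_pos hs']
    rw [h1, lintegral_indicator measurableSet_Iio, Measure.restrict_restrict measurableSet_Iio,
      Set.inter_comm, Set.Ioi_inter_Iio, Measure.restrict_congr_set Ioo_ae_eq_Ioc,
      ← ofReal_integral_eq_lintegral_ofReal, ← intervalIntegral.integral_of_le hb,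
      integral_rpow (Or.inl (by linarith))]
    · rw [ENNReal.ofReal_rpow_of_nonneg hb hr.le, ← ENNReal.ofReal_mul (by positivity)]
      congr 1
      simp only [sub_add_cancel, Real.zero_rpow hr.ne']
      ring
    · exact (intervalIntegrable_iff_integrableOn_Ioc_of_le hb).1
        (intervalIntegral.intervalIntegrable_rpow' (by linarith))
    · exact (ae_restrict_iff' measurableSet_Ioc).2
        (Filter.Eventually.of_forall fun s hs => Real.rpow_nonneg hs.1.le _)
  by_cases ha : a = ⊤
  · subst ha
    have h0 : ENNReal.ofReal (1 / r) ≠ 0 := by simpa using hr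
    rw [ENNReal.top_rpow_of_pos hr, ENNReal.mul_top h0, eq_top_iff]
    have hle : ∀ n : ℕ, ENNReal.ofReal (1 / r) * (ENNReal.ofReal n) ^ r ≤
      ∫⁻ s in Set.Ioi (0 : ℝ),
        (if ENNReal.ofReal s < ⊤ then (ENNReal.ofReal s) ^ (r - 1) else 0) := by
      intro n
      rw [← key n n.cast_nonneg]
      refine lintegral_mono fun s => ?_
      dsimp only
      rw [if_pos ENNReal.ofReal_lt_top]
      split_ifs <;> simp
    refine le_of_tendsto' (x := Filter.atTop) ?_ hle
    have h2 : Filter.Tendsto (fun n : ℕ => (ENNReal.ofReal n) ^ r) Filter.atTop (nhds ⊤) := by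
      have := (ENNReal.continuous_rpow_const (y := r)).tendsto ⊤
      rw [ENNReal.top_rpow_of_pos hr] at this
      refine this.comp ?_
      simpa using ENNReal.tendsto_nat_nhds_top
    have := ENNReal.Tendsto.const_mul (a := ENNReal.ofReal (1 / r)) h2 (Or.inl (by simp))
    rwa [ENNReal.mul_top h0] at this
  · have := key a.toReal ENNReal.toReal_nonneg
    rwa [ENNReal.ofReal_toReal ha] at this

noncomputable def RR (D : ℝ → ℝ≥0∞) (s : ℝ) : ℝ≥0∞ :=
  ⨆ t : ℝ, ⨆ _ : 0 < t ∧ ENNReal.ofReal s < D t, ENNReal.ofReal t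

lemma RR_anti (D : ℝ → ℝ≥0∞) : Antitone (RR D) := by
  intro s s' h
  refine iSup₂_le fun t ht => ?_
  exact le_iSup₂_of_le t ⟨ht.1, (ENNReal.ofReal_le_ofReal h).trans_lt ht.2⟩ le_rfl

lemma RR_le {D : ℝ → ℝ≥0∞} {s t : ℝ} (h0 : 0 < t) (h : ENNReal.ofReal s < D t) :
    ENNReal.ofReal t ≤ RR D s := le_iSup₂_of_le t ⟨h0, h⟩ le_rfl

lemma lt_RR {D : ℝ → ℝ≥0∞} (hD : Antitone D) {s t : ℝ} (h : ENNReal.ofReal t < RR D s) :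
    ENNReal.ofReal s < D t := by
  obtain ⟨t', h'⟩ := lt_iSup_iff.1 h
  obtain ⟨h1, h2⟩ := lt_iSup_iff.1 h'
  exact h1.2.trans_le (hD ((ENNReal.ofReal_lt_ofReal_iff h1.1).1 h2).le)

lemma layer {D : ℝ → ℝ≥0∞} (hD : Antitone D) {p q : ℝ} (hp : 0 < p) (hq : 0 < q) :
    ∫⁻ t in Set.Ioi (0 : ℝ), ENNReal.ofReal p * (ENNReal.ofReal t) ^ (q - 1) * (D t) ^ (q / p)
     = ∫⁻ s in Set.Ioi (0 : ℝ), (ENNReal.ofReal s) ^ (q / p - 1) * (RR D s) ^ q := by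
  have hr : 0 < q / p := by positivity
  have hDm : Measurable D := hD.measurable
  have e1 : ∀ t : ℝ, ENNReal.ofReal p * (ENNReal.ofReal t) ^ (q - 1) * (D t) ^ (q / p)
      = ∫⁻ s in Set.Ioi (0 : ℝ), ENNReal.ofReal q * (ENNReal.ofReal t) ^ (q - 1) *
        (if ENNReal.ofReal s < D t then (ENNReal.ofReal s) ^ (q / p - 1) else 0) := by
    intro t
    rw [lintegral_const_mul, lint_pow _ hr]
    · have : ENNReal.ofReal p = ENNReal.ofReal q * ENNReal.ofReal (1 / (q / p)) := by
        rw [← ENNReal.ofReal_mul hq.le]; congr 1; field_simp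
      rw [this]; ring
    · exact Measurable.ite (measurableSet_lt (by fun_prop) (by fun_prop)) (by fun_prop) (by fun_prop)
  simp_rw [e1]
  rw [lintegral_lintegral_swap]
  · refine setLIntegral_congr_fun measurableSet_Ioi ?_
    intro s hs
    dsimp only
    have e2 : (RR D s) ^ q = ENNReal.ofReal q * (ENNReal.ofReal (1 / q) * (RR D s) ^ q) := by
      rw [← mul_assoc, ← ENNReal.ofReal_mul hq.le, mul_one_div_cancel hq.ne']; simp
    rw [e2, ← lint_pow q hq, ← mul_assoc, ← lintegral_const_mul]
    · refine lintegral_congr_ae ?_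
      rw [Filter.EventuallyEq, ae_restrict_iff' measurableSet_Ioi]
      have : ∀ᵐ t : ℝ, t ≠ (RR D s).toReal := by simp [ae_iff]
      filter_upwards [this] with t ht ht0
      have ht0' : 0 < t := ht0
      have : ENNReal.ofReal s < D t ↔ ENNReal.ofReal t < RR D s := by
        refine ⟨fun h => lt_of_le_of_ne (RR_le ht0' h) ?_, lt_RR hD⟩
        intro h; apply ht; rw [← h, ENNReal.toReal_ofReal ht0'.le]
      simp only [this]
      split_ifs
      · ring
      · simp
    · exact Measurable.ite (measurableSet_lt (by fun_prop) (by fun_prop)) (by fun_prop) (by fun_prop)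
  · refine Measurable.aemeasurable ?_
    refine Measurable.mul (by fun_prop) ?_
    exact Measurable.ite (measurableSet_lt (by fun_prop) (by fun_prop)) (by fun_prop) (by fun_prop)

lemma layer_top {D : ℝ → ℝ≥0∞} (hD : Antitone D) {p : ℝ} (hp : 0 < p) :
    ⨆ t : ℝ, ⨆ _ : 0 < t, ENNReal.ofReal t * (D t) ^ (1 / p)
     = ⨆ s : ℝ, ⨆ _ : 0 < s, (ENNReal.ofReal s) ^ (1 / p) * RR D s := by
  have hp' : 0 < 1 / p := by positivity
  apply le_antisymm
  · refine iSup₂_le fun t ht => ?_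
    refine ENNReal.mul_le_of_forall_lt fun a ha b hb => ?_
    by_cases hb0 : b = 0
    · simp [hb0]
    have hbt : b ≠ ⊤ := hb.ne_top
    have hb' : ENNReal.ofReal ((b ^ p).toReal) = b ^ p :=
      ENNReal.ofReal_toReal (ENNReal.rpow_ne_top_of_nonneg hp.le hbt)
    have hlt : ENNReal.ofReal ((b ^ p).toReal) < D t := by
      rw [hb']
      have := ENNReal.rpow_lt_rpow hb hp
      rwa [← ENNReal.rpow_mul, one_div_mul_cancel hp.ne', ENNReal.rpow_one] at this
    refine le_iSup₂_of_le ((b ^ p).toReal) ?_ ?_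
    · exact ENNReal.toReal_pos (by simp [hb0, hbt]) (ENNReal.rpow_ne_top_of_nonneg hp.le hbt)
    · rw [hb', ← ENNReal.rpow_mul, mul_one_div_cancel hp.ne', ENNReal.rpow_one, mul_comm]
      gcongr
      exact ha.le.trans (RR_le ht hlt)
  · refine iSup₂_le fun s hs => ?_
    rw [RR]
    simp_rw [ENNReal.mul_iSup]
    refine iSup₂_le fun t ht => ?_
    refine le_iSup₂_of_le t ht.1 ?_
    rw [mul_comm]
    gcongr
    exact ht.2.le

lemma meas_RR {α : Type*} [MeasurableSpace α] (μ : Measure α) (f : α → ℝ) (s : ℝ) :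
    μ {x | RR (fun t => μ {x | t < |f x|}) s < ENNReal.ofReal |f x|} ≤ ENNReal.ofReal s := by
  set A := RR (fun t => μ {x | t < |f x|}) s with hA
  by_cases h : A = ⊤
  · simp [h]
  have hu : {x | A < ENNReal.ofReal |f x|} = ⋃ n : ℕ, {x | A.toReal + 1 / ((n : ℝ) + 1) < |f x|} := by
    ext x
    simp only [Set.mem_ofPred_eq, Set.mem_iUnion]
    rw [ENNReal.lt_ofReal_iff_toReal_lt h]
    constructor
    · intro hx
      obtain ⟨n, hn⟩ := exists_nat_one_div_lt (sub_pos.2 hx)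
      exact ⟨n, by linarith⟩
    · rintro ⟨n, hn⟩
      have : (0:ℝ) < 1 / ((n : ℝ) + 1) := by positivity
      linarith
  rw [hu, Monotone.measure_iUnion]
  · refine iSup_le fun n => ?_
    by_contra! hn
    have h1 : (0:ℝ) < 1 / ((n : ℝ) + 1) := by positivity
    have h2 := RR_le (D := fun t => μ {x | t < |f x|}) (by positivity) hn
    rw [← hA, ENNReal.ofReal_le_iff_le_toReal h] at h2
    linarith
  · intro m n hmn x hx
    simp only [Set.mem_ofPred_eq] at hx ⊢
    have := Nat.one_div_le_one_div (α := ℝ) hmn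
    linarith

lemma RR_mul {α : Type*} [MeasurableSpace α] (μ : Measure α) (f g : α → ℝ) (s : ℝ) :
    RR (fun t => μ {x | t < |f x * g x|} / 2) s ≤
      RR (fun t => μ {x | t < |f x|}) s * RR (fun t => μ {x | t < |g x|}) s := by
  refine iSup₂_le fun t ht => ?_
  by_contra! hlt
  refine ht.2.not_ge ?_
  rw [ENNReal.div_le_iff (by simp) (by simp), mul_two]
  refine le_trans ?_ (add_le_add (meas_RR μ f s) (meas_RR μ g s))
  refine le_trans (measure_mono ?_) (measure_union_le _ _)
  intro x hx
  by_contra hc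
  simp only [Set.mem_union, Set.mem_ofPred_eq, not_or, not_lt] at hc hx
  have h1 := mul_le_mul' hc.1 hc.2
  rw [← ENNReal.ofReal_mul (abs_nonneg _), ← abs_mul] at h1
  have := (ENNReal.ofReal_lt_ofReal_iff ht.1).1 (h1.trans_lt hlt)
  linarith

noncomputable def Nn (F : ℝ → ℝ≥0∞) (p : ℝ) (q : ℝ≥0∞) : ℝ≥0∞ :=
  if q = ⊤ then ⨆ s : ℝ, ⨆ _ : 0 < s, (ENNReal.ofReal s) ^ (1 / p) * F s
  else (∫⁻ s in Set.Ioi (0 : ℝ),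
    (ENNReal.ofReal s) ^ (q.toReal / p - 1) * (F s) ^ q.toReal) ^ (1 / q.toReal)

lemma dist_anti {α : Type*} [MeasurableSpace α] (μ : Measure α) (f : α → ℝ) :
    Antitone (fun t : ℝ => μ {x | t < |f x|}) :=
  fun _ _ h => measure_mono fun _ hx => lt_of_le_of_lt h hx

lemma norm_eq {α : Type*} [MeasurableSpace α] (μ : Measure α) (f : α → ℝ) {p : ℝ} {q : ℝ≥0∞}
    (hp : 0 < p) (hq : q ≠ 0) :
    lorentzNorm μ p q f = Nn (RR (fun t => μ {x | t < |f x|})) p q := by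
  unfold lorentzNorm Nn
  split_ifs with h
  · exact layer_top (dist_anti μ f) hp
  · rw [← layer (dist_anti μ f) hp (ENNReal.toReal_pos hq h)]

lemma norm_eq_half {α : Type*} [MeasurableSpace α] (μ : Measure α) (f : α → ℝ) {p : ℝ} {q : ℝ≥0∞}
    (hp : 0 < p) (hq : q ≠ 0) :
    lorentzNorm μ p q f = (2 : ℝ≥0∞) ^ (1 / p) * Nn (RR (fun t => μ {x | t < |f x|} / 2)) p q := by
  have hA : Antitone (fun t : ℝ => μ {x | t < |f x|} / 2) :=
    fun _ _ h => ENNReal.div_le_div_right (dist_anti μ f h) 2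
  have hpow : ∀ (a : ℝ≥0∞) (r : ℝ), 0 ≤ r → a ^ r = 2 ^ r * (a / 2) ^ r := by
    intro a r hr
    rw [← ENNReal.mul_rpow_of_nonneg _ _ hr, ENNReal.mul_div_cancel (by simp) (by simp)]
  unfold lorentzNorm Nn
  split_ifs with h
  · rw [← layer_top hA hp]
    simp_rw [ENNReal.mul_iSup]
    refine iSup_congr fun t => iSup_congr fun _ => ?_
    rw [hpow _ (1 / p) (by positivity)]
    ring
  · have hq' := ENNReal.toReal_pos hq h
    rw [← layer hA hp hq']
    have h2 : (2 : ℝ≥0∞) ^ (1 / p) = ((2 : ℝ≥0∞) ^ (q.toReal / p)) ^ (1 / q.toReal) := by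
      rw [← ENNReal.rpow_mul]; congr 1; field_simp
    rw [h2, ← ENNReal.mul_rpow_of_nonneg _ _ (by positivity), ← lintegral_const_mul']
    · congr 1
      refine lintegral_congr fun t => ?_
      rw [hpow _ (q.toReal / p) (by positivity)]
      ring
    · exact ENNReal.rpow_ne_top_of_nonneg (by positivity) (by simp)

lemma Nn_top {F G H : ℝ → ℝ≥0∞} (hH : ∀ s, H s ≤ F s * G s) (hF : Measurable F) {p p₁ p₂ : ℝ} {q : ℝ≥0∞}
    (hq : q ≠ 0) (hp₁ : 0 < p₁) (hp₂ : 0 < p₂)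
    (hp : 1 / p = 1 / p₁ + 1 / p₂) :
    Nn H p q ≤ Nn F p₁ q * Nn G p₂ ⊤ := by
  have hpt : ∀ s : ℝ, 0 < s → (ENNReal.ofReal s) ^ (1 / p) =
      (ENNReal.ofReal s) ^ (1 / p₁) * (ENNReal.ofReal s) ^ (1 / p₂) := by
    intro s hs
    rw [hp, ENNReal.rpow_add _ _ (by simpa using hs) (by simp)]
  have hG : ∀ s : ℝ, 0 < s → (ENNReal.ofReal s) ^ (1 / p₂) * G s ≤ Nn G p₂ ⊤ := by
    intro s hs
    simp only [Nn, if_true]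
    exact le_iSup₂_of_le s hs le_rfl
  generalize Nn G p₂ ⊤ = K at hG
  unfold Nn
  split_ifs with h
  · refine iSup₂_le fun s hs => ?_
    rw [hpt s hs]
    calc _ ≤ (ENNReal.ofReal s) ^ (1 / p₁) * (ENNReal.ofReal s) ^ (1 / p₂) * (F s * G s) := by
            gcongr; exact hH s
      _ = ((ENNReal.ofReal s) ^ (1 / p₁) * F s) * ((ENNReal.ofReal s) ^ (1 / p₂) * G s) := by ring
      _ ≤ _ := mul_le_mul' (le_iSup₂_of_le s hs le_rfl) (hG s hs)
  · have hq' := ENNReal.toReal_pos hq h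
    set r := q.toReal
    have hK : K = (K ^ r) ^ (1 / r) := by
      rw [← ENNReal.rpow_mul, mul_one_div_cancel hq'.ne', ENNReal.rpow_one]
    rw [hK, ← ENNReal.mul_rpow_of_nonneg _ _ (by positivity)]
    refine ENNReal.rpow_le_rpow ?_ (by positivity)
    rw [← lintegral_mul_const _ (by fun_prop)]
    refine setLIntegral_mono' measurableSet_Ioi ?_
    intro s hs
    have hs' : 0 < s := hs
    have e : (ENNReal.ofReal s) ^ (r / p - 1) =
        (ENNReal.ofReal s) ^ (r / p₁ - 1) * ((ENNReal.ofReal s) ^ (1 / p₂)) ^ r := by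
      rw [← ENNReal.rpow_mul, ← ENNReal.rpow_add _ _ (by simpa using hs) (by simp)]
      congr 1
      have : r / p = r * (1 / p) := by ring
      rw [this, hp]; ring
    rw [e]
    calc _ ≤ (ENNReal.ofReal s) ^ (r / p₁ - 1) * ((ENNReal.ofReal s) ^ (1 / p₂)) ^ r
            * (F s * G s) ^ r := by
            gcongr; exact hH s
      _ = ((ENNReal.ofReal s) ^ (r / p₁ - 1) * F s ^ r) *
          ((ENNReal.ofReal s) ^ (1 / p₂) * G s) ^ r := by
            rw [ENNReal.mul_rpow_of_nonneg _ _ hq'.le, ENNReal.mul_rpow_of_nonneg _ _ hq'.le]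
            ring
      _ ≤ _ := by gcongr; exact hG s hs'

lemma Nn_fin {F G H : ℝ → ℝ≥0∞} (hH : ∀ s, H s ≤ F s * G s) (hF : Measurable F)
    (hG : Measurable G) {p p₁ p₂ : ℝ} {q q₁ q₂ : ℝ}
    (hq0 : 0 < q) (hq₁ : 0 < q₁) (hq₂ : 0 < q₂) 
    (hp : 1 / p = 1 / p₁ + 1 / p₂) (hq : 1 / q = 1 / q₁ + 1 / q₂) :
    (∫⁻ s in Set.Ioi (0 : ℝ), (ENNReal.ofReal s) ^ (q / p - 1) * (H s) ^ q) ^ (1 / q) ≤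
    (∫⁻ s in Set.Ioi (0 : ℝ), (ENNReal.ofReal s) ^ (q₁ / p₁ - 1) * (F s) ^ q₁) ^ (1 / q₁) *
    (∫⁻ s in Set.Ioi (0 : ℝ), (ENNReal.ofReal s) ^ (q₂ / p₂ - 1) * (G s) ^ q₂) ^ (1 / q₂) := by
  have hlt : q < q₁ := by
    rw [← one_div_lt_one_div hq₁ hq0, hq]
    have : 0 < 1 / q₂ := by positivity
    linarith
  have main := ENNReal.lintegral_Lp_mul_le_Lq_mul_Lr hq0 hlt hq (volume.restrict (Set.Ioi (0 : ℝ)))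
    (f := fun s => (ENNReal.ofReal s) ^ (1 / p₁ - 1 / q₁) * F s)
    (g := fun s => (ENNReal.ofReal s) ^ (1 / p₂ - 1 / q₂) * G s)
    (by fun_prop) (by fun_prop)
  have hh : ∀ (F : ℝ → ℝ≥0∞) (p q : ℝ), 0 < q → 
      ∫⁻ s in Set.Ioi (0 : ℝ), ((ENNReal.ofReal s) ^ (1 / p - 1 / q) * F s) ^ q =
      ∫⁻ s in Set.Ioi (0 : ℝ), (ENNReal.ofReal s) ^ (q / p - 1) * (F s) ^ q := by
    intro F p q hq
    refine lintegral_congr fun s => ?_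
    rw [ENNReal.mul_rpow_of_nonneg _ _ hq.le, ← ENNReal.rpow_mul]
    congr 2
    field_simp
  rw [hh F _ _ hq₁, hh G _ _ hq₂] at main
  refine le_trans ?_ main
  refine ENNReal.rpow_le_rpow ?_ (by positivity)
  rw [← hh H _ _ hq0]
  refine setLIntegral_mono' measurableSet_Ioi ?_
  intro s hs
  refine ENNReal.rpow_le_rpow ?_ hq0.le
  have e : (1 / p - 1 / q) = (1 / p₁ - 1 / q₁) + (1 / p₂ - 1 / q₂) := by rw [hp, hq]; ring
  rw [e, ENNReal.rpow_add _ _ (by simpa using hs) (by simp)]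
  calc _ ≤ _ * (F s * G s) := mul_le_mul_right (hH s) _
    _ = _ := by simp only [Pi.mul_apply]; ring

/-- Hölder's inequality in Lorentz spaces: if `1 ≤ p₁, p₂ < ∞`, `1 ≤ q₁, q₂ ≤ ∞`,
`1/p = 1/p₁ + 1/p₂ < 1` and `1/q = 1/q₁ + 1/q₂`, then there is a constant `C`
depending only on the exponents with
`‖fg‖_{L^{p,q}} ≤ C ‖f‖_{L^{p₁,q₁}} ‖g‖_{L^{p₂,q₂}}` for all measurable `f, g`
on any σ-finite measure space. -/
theorem lorentzNorm_holder (p p₁ p₂ : ℝ) (q q₁ q₂ : ℝ≥0∞)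
    (hp₁ : 1 ≤ p₁) (hp₂ : 1 ≤ p₂) (hq₁ : 1 ≤ q₁) (hq₂ : 1 ≤ q₂)
    (hp : 1 / p = 1 / p₁ + 1 / p₂) (hp1 : 1 / p < 1)
    (hq : q⁻¹ = q₁⁻¹ + q₂⁻¹) :
    ∃ C : ℝ≥0, 0 < C ∧
      ∀ (α : Type) (_ : MeasurableSpace α) (μ : Measure α), SigmaFinite μ →
        ∀ f g : α → ℝ, Measurable f → Measurable g →
          lorentzNorm μ p q (fun x => f x * g x) ≤
            C * lorentzNorm μ p₁ q₁ f * lorentzNorm μ p₂ q₂ g := by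
  have hp₁' : 0 < p₁ := by linarith
  have hp₂' : 0 < p₂ := by linarith
  have hp' : 0 < p := by
    have : 0 < 1 / p := by rw [hp]; positivity
    exact one_div_pos.1 this
  have hq₁0 : q₁ ≠ 0 := (zero_lt_one.trans_le hq₁).ne'
  have hq₂0 : q₂ ≠ 0 := (zero_lt_one.trans_le hq₂).ne'
  have hq0 : q ≠ 0 := by
    rintro rfl
    rw [ENNReal.inv_zero] at hq
    have := hq.symm
    simp [hq₁0, hq₂0] at this
  refine ⟨(2 : ℝ≥0) ^ (1 / p), by positivity, ?_⟩
  intro α _ μ _ f g _ _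
  rw [norm_eq_half μ _ hp' hq0, norm_eq μ f hp₁' hq₁0, norm_eq μ g hp₂' hq₂0,
    ENNReal.coe_rpow_of_nonneg _ (by positivity), mul_assoc]
  refine mul_le_mul' (by simp) ?_
  have hH := RR_mul μ f g
  have hF := (RR_anti (fun t => μ {x | t < |f x|})).measurable
  have hG := (RR_anti (fun t => μ {x | t < |g x|})).measurable
  by_cases h2 : q₂ = ⊤
  · subst h2
    have : q = q₁ := by simpa using hq
    subst this
    exact Nn_top hH hF hq0 hp₁' hp₂' hp
  by_cases h1 : q₁ = ⊤
  · subst h1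
    have : q = q₂ := by simpa using hq
    subst this
    rw [mul_comm]
    exact Nn_top (fun s => (hH s).trans_eq (mul_comm _ _)) hG hq0 hp₂' hp₁' (by rw [hp, add_comm])
  have h : q ≠ ⊤ := by
    rintro rfl
    rw [ENNReal.inv_top] at hq
    have := hq.symm
    simp [h1] at this
  have hqr : 1 / q.toReal = 1 / q₁.toReal + 1 / q₂.toReal := by
    have := congrArg ENNReal.toReal hq
    rw [ENNReal.toReal_add (by simp [hq₁0]) (by simp [hq₂0])] at this
    simpa [ENNReal.toReal_inv] using this
  simp only [Nn, if_neg h, if_neg h1, if_neg h2]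
  exact Nn_fin hH hF hG (ENNReal.toReal_pos hq0 h) (ENNReal.toReal_pos hq₁0 h1)
    (ENNReal.toReal_pos hq₂0 h2) hp hqr
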